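/- For every integer M ≥ 0, Σ_{i=0}^{M} Σ_{j=0}^{2m} binom(2m, j) · M! · (m + (m+M) − 2j − 3i + 1) / ( i! · ((m+M) − j − 2i + 1)! · (i + j − m)! ) = Σ_{i=0}^{M} (−1)^i · binom(M, i) · C_{m+M−i} for all m ≥ 0, where on the left a summand is zero whenever any factorial argument is negative, and C_k denotes the k-th Catalan number. (Equivalently, with n = m + M, the double-sum formula for κ_{2m,n−m} simplifies to the alternating sum Σ_{i=0}^{n−m} (−1)^i binom(n−m,i) C_{n−i}.) -/

import Mathlib

open Polynomial in
/-- The coefficients of `(1 + X) ^ N * (X - 1)`, in a closed form symmetric in `a` and `c`. -/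
theorem coeff_one_add_X_pow_mul_X_sub_one {N a c : ℕ} (h : a + c = N + 1) :
    ((1 + X : ℚ[X]) ^ N * (X - 1)).coeff a =
      (N.factorial : ℚ) * ((a : ℚ) - c) / ((a.factorial : ℚ) * c.factorial) := by
  rw [mul_sub, mul_one, coeff_sub]
  rcases a with _ | a
  · obtain rfl : c = N + 1 := by omega
    have hN : (N.factorial : ℚ) ≠ 0 := by positivity
    have hN' : (N : ℚ) + 1 ≠ 0 := by positivity
    simp only [mul_coeff_zero, coeff_X_zero, coeff_one_add_X_pow, Nat.factorial_succ]
    push_cast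
    field_simp
    simp
  · obtain rfl : N = a + c := by omega
    rw [coeff_mul_X, coeff_one_add_X_pow, coeff_one_add_X_pow, Nat.cast_add_choose]
    have ha : (a.factorial : ℚ) ≠ 0 := by positivity
    have ha' : (a : ℚ) + 1 ≠ 0 := by positivity
    rcases c with _ | c
    · simp [Nat.factorial_succ]
      field_simp
    · have hc : (c.factorial : ℚ) ≠ 0 := by positivity
      have hc' : (c : ℚ) + 1 ≠ 0 := by positivity
      rw [show a + (c + 1) = (a + 1) + c by ring, Nat.cast_add_choose,
        Nat.factorial_succ a, Nat.factorial_succ c]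
      push_cast
      field_simp

open Polynomial in
theorem coeff_one_add_X_pow_mul_X_sub_one_eq_zero {N a : ℕ} (h : N + 1 < a) :
    ((1 + X : ℚ[X]) ^ N * (X - 1)).coeff a = 0 := by
  obtain ⟨a, rfl⟩ : ∃ b, a = b + 1 := ⟨a - 1, by omega⟩
  rw [mul_sub, mul_one, coeff_sub, coeff_mul_X, coeff_one_add_X_pow, coeff_one_add_X_pow,
    Nat.choose_eq_zero_of_lt (by omega), Nat.choose_eq_zero_of_lt (by omega), sub_self]

open Polynomial in
theorem catalan_eq_coeff (k : ℕ) :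
    (catalan k : ℚ) = ((1 + X : ℚ[X]) ^ (2 * k) * (X - 1)).coeff (k + 1) := by
  rw [coeff_one_add_X_pow_mul_X_sub_one (c := k) (by ring)]
  have h : ((k + 1 : ℕ) : ℚ) * catalan k = (k + k).choose k := by
    rw [← two_mul]
    exact_mod_cast succ_mul_catalan_eq_centralBinom k
  rw [Nat.cast_add_choose, ← two_mul] at h
  have hk : (k.factorial : ℚ) ≠ 0 := by positivity
  have hk' : (k : ℚ) + 1 ≠ 0 := by positivity
  rw [Nat.factorial_succ]
  push_cast at h ⊢
  field_simp at h ⊢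
  linear_combination h

open Polynomial in
/-- The alternating sum of Catalan numbers as a single polynomial coefficient. -/
theorem alternating_sum_catalan_eq_coeff (M m : ℕ) :
    ∑ i ∈ Finset.range (M + 1), (-1 : ℚ) ^ i * (M.choose i : ℚ) * (catalan (m + M - i) : ℚ) =
      ((1 + X : ℚ[X]) ^ (2 * m) * (X ^ 2 + (1 + X)) ^ M * (X - 1)).coeff (m + M + 1) := by
  have key : (X ^ 2 + (1 + X) : ℚ[X]) = -X + (1 + X) ^ 2 := by ring
  rw [key, add_pow (-X) ((1 + X) ^ 2) M, Finset.mul_sum, Finset.sum_mul, finsetSum_coeff]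
  refine Finset.sum_congr rfl fun i hi => ?_
  have hi : i ≤ M := Finset.mem_range_succ_iff.mp hi
  obtain ⟨N, rfl⟩ := Nat.exists_eq_add_of_le hi
  have hp : (1 + X : ℚ[X]) ^ (2 * m) *
      ((-X) ^ i * ((1 + X) ^ 2) ^ (i + N - i) * ((i + N).choose i : ℚ[X])) * (X - 1) =
      C ((-1 : ℚ) ^ i * ((i + N).choose i : ℚ)) *
        (X ^ i * ((1 + X) ^ (2 * (m + N)) * (X - 1))) := by
    rw [Nat.add_sub_cancel_left, neg_pow, ← pow_mul]
    simp only [map_mul, map_pow, map_neg, map_one, map_natCast]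
    ring
  rw [hp, coeff_C_mul, show m + (i + N) + 1 = m + N + 1 + i by ring, coeff_X_pow_mul,
    show m + (i + N) - i = m + N by omega, catalan_eq_coeff]

open Polynomial in
/-- For all `M ≥ 0` and `m ≥ 0` (writing `n = m + M`), the double-sum
formula for `κ_{2m, n−m}` simplifies to the alternating sum:
`Σ_{i=0}^{M} Σ_{j=0}^{2m} C(2m,j)·M!·(m+(m+M)−2j−3i+1)/(i!·((m+M)−j−2i+1)!·(i+j−m)!)
  = Σ_{i=0}^{M} (−1)^i·C(M,i)·C_{m+M−i}`,
where on the left a summand is declared to be `0` whenever one of the factorial arguments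
`(m+M)−j−2i+1` or `i+j−m` is negative, and `C_k` is the `k`-th Catalan number. -/
theorem double_sum_eq_alternating_sum_catalan (M m : ℕ) :
    (∑ i ∈ Finset.range (M + 1), ∑ j ∈ Finset.range (2 * m + 1),
        if j + 2 * i ≤ m + M + 1 ∧ m ≤ i + j then
          ((2 * m).choose j : ℚ) * (M.factorial : ℚ) *
              ((m : ℚ) + ((m : ℚ) + (M : ℚ)) - 2 * (j : ℚ) - 3 * (i : ℚ) + 1) /
            ((i.factorial : ℚ) * ((m + M + 1 - j - 2 * i).factorial : ℚ) *
              ((i + j - m).factorial : ℚ))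
        else 0) =
      ∑ i ∈ Finset.range (M + 1),
        (-1 : ℚ) ^ i * (M.choose i : ℚ) * (catalan (m + M - i) : ℚ) := by
  rw [alternating_sum_catalan_eq_coeff, add_pow (X ^ 2) (1 + X) M, Finset.mul_sum, Finset.sum_mul,
    finsetSum_coeff]
  refine Finset.sum_congr rfl fun i hi => ?_
  have hi : i ≤ M := Finset.mem_range_succ_iff.mp hi
  obtain ⟨N, rfl⟩ := Nat.exists_eq_add_of_le hi
  have hp : (1 + X : ℚ[X]) ^ (2 * m) *
      ((X ^ 2) ^ i * (1 + X) ^ (i + N - i) * ((i + N).choose i : ℚ[X])) * (X - 1) =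
      ∑ j ∈ Finset.range (2 * m + 1), C (((2 * m).choose j : ℚ) * ((i + N).choose i : ℚ)) *
        (X ^ (j + 2 * i) * ((1 + X) ^ N * (X - 1))) := by
    rw [Nat.add_sub_cancel_left, add_comm (1 : ℚ[X]) X, add_pow X 1 (2 * m), Finset.sum_mul,
      Finset.sum_mul]
    refine Finset.sum_congr rfl fun j _ => ?_
    simp only [map_mul, map_natCast, one_pow]
    ring
  rw [hp, finsetSum_coeff]
  refine Finset.sum_congr rfl fun j _ => ?_
  rw [coeff_C_mul, coeff_X_pow_mul']
  by_cases h₁ : j + 2 * i ≤ m + (i + N) + 1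
  · rw [if_pos h₁]
    by_cases h₂ : m ≤ i + j
    · obtain ⟨c, hc⟩ := Nat.exists_eq_add_of_le h₂
      obtain ⟨a, ha⟩ := Nat.exists_eq_add_of_le h₁
      rw [if_pos ⟨h₁, h₂⟩, show m + (i + N) + 1 - (j + 2 * i) = a by omega,
        show m + (i + N) + 1 - j - 2 * i = a by omega, show i + j - m = c by omega,
        coeff_one_add_X_pow_mul_X_sub_one (c := c) (by omega), Nat.cast_add_choose]
      have hcq : (i : ℚ) + j = m + c := by exact_mod_cast hc
      have haq : (m : ℚ) + (i + N) + 1 = j + 2 * i + a := by exact_mod_cast ha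
      have hnum : (m : ℚ) + (m + (i + N : ℕ)) - 2 * j - 3 * i + 1 = a - c := by
        push_cast
        linear_combination haq - hcq
      have hN : (N.factorial : ℚ) ≠ 0 := by positivity
      rw [hnum]
      field_simp
    · rw [if_neg (fun h => h₂ h.2), coeff_one_add_X_pow_mul_X_sub_one_eq_zero (by omega),
        mul_zero]
  · rw [if_neg h₁, if_neg (fun h => h₁ h.1), mul_zero]
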